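/- Let μ>0, c₂>0 and 0 < β < 1. Then there exist constants T₀ > 0 and C > 0 such that for all 0 < T < T₀ and all q ∈ ℝ² with |q| < c₂ √μ (T/μ)^β, one has ∫_ℝ ( ∫_ℝ B_T((p₁,p₂), q) dp₁ )² dp₂ ≥ C · (log(μ/T))³. -/

import Mathlib

open MeasureTheory Real

/-- The function `B_T(p,q)` on `ℝ² × ℝ²`, set to `0` on the measure-zero set
`|p|² + |q|² = μ` where the defining expression is singular. -/
noncomputable def BT (T μ : ℝ) (p q : ℝ × ℝ) : ℝ :=
  if p.1 ^ 2 + p.2 ^ 2 + q.1 ^ 2 + q.2 ^ 2 = μ then 0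
  else
    (Real.tanh (((p.1 + q.1) ^ 2 + (p.2 + q.2) ^ 2 - μ) / (2 * T)) +
        Real.tanh (((p.1 - q.1) ^ 2 + (p.2 - q.2) ^ 2 - μ) / (2 * T))) /
      (2 * (p.1 ^ 2 + p.2 ^ 2 + q.1 ^ 2 + q.2 ^ 2 - μ))

lemma Real.hasDerivAt_tanh (x : ℝ) : HasDerivAt Real.tanh (1 / Real.cosh x ^ 2) x := by
  have h := (Real.hasDerivAt_sinh x).div (Real.hasDerivAt_cosh x) (Real.cosh_pos x).ne'
  have e : Real.tanh = Real.sinh / Real.cosh := by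
    ext y; exact Real.tanh_eq_sinh_div_cosh y
  rw [e]
  rwa [show Real.cosh x * Real.cosh x - Real.sinh x * Real.sinh x = 1 by
    nlinarith [Real.cosh_sq x]] at h

lemma Real.continuous_tanh : Continuous Real.tanh :=
  continuous_iff_continuousAt.2 fun x => (Real.hasDerivAt_tanh x).continuousAt

lemma Real.monotone_tanh : Monotone Real.tanh :=
  monotone_of_deriv_nonneg (fun x => (Real.hasDerivAt_tanh x).differentiableAt)
    fun x => by rw [(Real.hasDerivAt_tanh x).deriv]; positivity

lemma Real.monotone_id_sub_tanh : Monotone fun x : ℝ => x - Real.tanh x := by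
  have hd : ∀ x : ℝ, HasDerivAt (fun x : ℝ => x - Real.tanh x) (1 - 1 / Real.cosh x ^ 2) x :=
    fun x => (hasDerivAt_id x).sub (Real.hasDerivAt_tanh x)
  refine monotone_of_deriv_nonneg (fun x => (hd x).differentiableAt) fun x => ?_
  rw [(hd x).deriv, sub_nonneg, div_le_one (pow_pos (Real.cosh_pos x) 2)]
  nlinarith [Real.one_le_cosh x]

lemma Real.tanh_add_tanh_nonneg {x y : ℝ} (h : 0 ≤ x + y) : 0 ≤ Real.tanh x + Real.tanh y := by
  have := Real.monotone_tanh (show -y ≤ x by linarith)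
  rw [Real.tanh_neg] at this
  linarith

lemma Real.tanh_add_tanh_le {x y : ℝ} (h : 0 ≤ x + y) : Real.tanh x + Real.tanh y ≤ x + y := by
  have := Real.monotone_id_sub_tanh (show -y ≤ x by linarith)
  simp only [Real.tanh_neg] at this
  linarith

lemma Real.abs_tanh_add_tanh_le (x y : ℝ) : |Real.tanh x + Real.tanh y| ≤ |x + y| := by
  rcases le_total 0 (x + y) with h | h
  · rw [abs_of_nonneg h, abs_of_nonneg (Real.tanh_add_tanh_nonneg h)]
    exact Real.tanh_add_tanh_le h
  · have h' : 0 ≤ -x + -y := by linarith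
    have h1 := Real.tanh_add_tanh_nonneg h'
    have h2 := Real.tanh_add_tanh_le h'
    simp only [Real.tanh_neg] at h1 h2
    rw [abs_of_nonpos h, abs_of_nonpos (by linarith)]
    linarith

lemma Real.half_le_tanh {x : ℝ} (h : 1 ≤ x) : 1 / 2 ≤ Real.tanh x := by
  rw [Real.tanh_eq, div_le_div_iff₀ (by norm_num) (by positivity)]
  have h1 := Real.add_one_le_exp (2 * x)
  have h2 : Real.exp x = Real.exp (2 * x) * Real.exp (-x) := by
    rw [← Real.exp_add]; ring_nf
  nlinarith [Real.exp_pos (-x)]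

lemma BT_nonneg {T : ℝ} (hT : 0 < T) (μ : ℝ) (p q : ℝ × ℝ) : 0 ≤ BT T μ p q := by
  unfold BT
  split_ifs with h
  · exact le_rfl
  · set x := ((p.1 + q.1) ^ 2 + (p.2 + q.2) ^ 2 - μ) / (2 * T) with hx
    set y := ((p.1 - q.1) ^ 2 + (p.2 - q.2) ^ 2 - μ) / (2 * T) with hy
    have hxy : 2 * (p.1 ^ 2 + p.2 ^ 2 + q.1 ^ 2 + q.2 ^ 2 - μ) = 2 * T * (x + y) := by
      rw [hx, hy]; field_simp; ring
    rw [hxy]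
    rcases le_total 0 (x + y) with h0 | h0
    · exact div_nonneg (Real.tanh_add_tanh_nonneg h0) (by positivity)
    · have := Real.tanh_add_tanh_nonneg (show 0 ≤ -x + -y by linarith)
      simp only [Real.tanh_neg] at this
      exact div_nonneg_of_nonpos (by linarith)
        (mul_nonpos_of_nonneg_of_nonpos (by positivity) h0)

lemma BT_le {T μ : ℝ} (hT : 0 < T) (hμ : 0 < μ) (p q : ℝ × ℝ) :
    BT T μ p q ≤ ((μ + 1) / T + 2) / (1 + p.1 ^ 2 + p.2 ^ 2) := by
  have hP : 0 < 1 + p.1 ^ 2 + p.2 ^ 2 := by positivity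
  unfold BT
  split_ifs with h
  · positivity
  · set x := ((p.1 + q.1) ^ 2 + (p.2 + q.2) ^ 2 - μ) / (2 * T) with hx
    set y := ((p.1 - q.1) ^ 2 + (p.2 - q.2) ^ 2 - μ) / (2 * T) with hy
    set D := p.1 ^ 2 + p.2 ^ 2 + q.1 ^ 2 + q.2 ^ 2 - μ with hD
    have hxy : x + y = D / T := by
      rw [hx, hy, hD]; field_simp; ring
    have hD0 : D ≠ 0 := fun h0 => h (by rw [hD] at h0; linarith)
    rcases le_total (p.1 ^ 2 + p.2 ^ 2) (2 * μ + 1) with hp | hp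
    · have h1 : (Real.tanh x + Real.tanh y) / (2 * D) ≤ 1 / (2 * T) := by
        refine (le_abs_self _).trans ?_
        rw [abs_div, abs_mul, abs_two]
        have := Real.abs_tanh_add_tanh_le x y
        rw [hxy, abs_div, abs_of_pos hT] at this
        rw [div_le_iff₀ (by positivity)]
        refine this.trans (le_of_eq ?_)
        field_simp
      refine h1.trans ?_
      rw [le_div_iff₀ hP]
      have : 1 / (2 * T) * (1 + p.1 ^ 2 + p.2 ^ 2) ≤ 1 / (2 * T) * (2 * (μ + 1)) := by
        gcongr; linarith
      refine this.trans ?_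
      have e : 1 / (2 * T) * (2 * (μ + 1)) = (μ + 1) / T := by field_simp
      linarith
    · have hDp : (1 + p.1 ^ 2 + p.2 ^ 2) / 2 ≤ D := by
        rw [hD]; nlinarith [sq_nonneg q.1, sq_nonneg q.2]
      have hDpos : 0 < D := by linarith
      have h2 : (Real.tanh x + Real.tanh y) / (2 * D) ≤ 1 / D := by
        rw [div_le_div_iff₀ (by positivity) hDpos]
        nlinarith [Real.tanh_lt_one x, Real.tanh_lt_one y]
      refine h2.trans ?_
      rw [div_le_div_iff₀ hDpos hP]
      have : 0 < (μ + 1) / T := by positivity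
      nlinarith

lemma measurable_BT (T μ : ℝ) (q : ℝ × ℝ) : Measurable fun p : ℝ × ℝ => BT T μ p q := by
  have := Real.continuous_tanh.measurable
  unfold BT
  refine Measurable.ite (measurableSet_eq_fun (by fun_prop) (by fun_prop)) (by fun_prop) ?_
  fun_prop

/-- A product majorant of `1 / (1 + x² + y²)`, integrable in `x` and square integrable in `y`. -/
lemma inv_one_add_sq_add_sq_le (x y : ℝ) :
    1 / (1 + x ^ 2 + y ^ 2) ≤
      (1 + x ^ 2) ^ (-(2 / 3) : ℝ) * (1 + y ^ 2) ^ (-(1 / 3) : ℝ) := by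
  have hM : 0 < 1 + x ^ 2 + y ^ 2 := by positivity
  calc 1 / (1 + x ^ 2 + y ^ 2)
      = (1 + x ^ 2 + y ^ 2) ^ (-(2 / 3) : ℝ) * (1 + x ^ 2 + y ^ 2) ^ (-(1 / 3) : ℝ) := by
        rw [← Real.rpow_add hM, show (-(2 / 3) + -(1 / 3) : ℝ) = -1 by norm_num,
          Real.rpow_neg_one, one_div]
    _ ≤ _ := by
        refine mul_le_mul ?_ ?_ (by positivity) (by positivity)
        · exact Real.rpow_le_rpow_of_nonpos (by positivity) (by nlinarith) (by norm_num)
        · exact Real.rpow_le_rpow_of_nonpos (by positivity) (by nlinarith) (by norm_num)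

lemma integrable_one_add_sq_rpow :
    Integrable fun x : ℝ => (1 + x ^ 2) ^ (-(2 / 3) : ℝ) := by
  have := integrable_rpow_neg_one_add_norm_sq (E := ℝ) (μ := volume) (r := 4 / 3)
    (by norm_num)
  convert this using 3
  · simp
  · norm_num

lemma BT_le_mul {T μ : ℝ} (hT : 0 < T) (hμ : 0 < μ) (x y : ℝ) (q : ℝ × ℝ) :
    BT T μ (x, y) q ≤ (((μ + 1) / T + 2) * (1 + y ^ 2) ^ (-(1 / 3) : ℝ)) *
      (1 + x ^ 2) ^ (-(2 / 3) : ℝ) := by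
  refine (BT_le hT hμ (x, y) q).trans ?_
  have h := mul_le_mul_of_nonneg_left (inv_one_add_sq_add_sq_le x y)
    (show 0 ≤ (μ + 1) / T + 2 by positivity)
  rw [mul_one_div] at h
  exact h.trans (le_of_eq (by ring))

lemma integrable_BT_fst {T μ : ℝ} (hT : 0 < T) (hμ : 0 < μ) (y : ℝ) (q : ℝ × ℝ) :
    Integrable fun x : ℝ => BT T μ (x, y) q := by
  refine (integrable_one_add_sq_rpow.const_mul
    (((μ + 1) / T + 2) * (1 + y ^ 2) ^ (-(1 / 3) : ℝ))).mono'
    ((measurable_BT T μ q).comp (by fun_prop : Measurable fun x : ℝ => (x, y))).aestronglyMeasurable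
    (Filter.Eventually.of_forall fun x => ?_)
  rw [Real.norm_of_nonneg (BT_nonneg hT μ _ q)]
  exact BT_le_mul hT hμ x y q

lemma integrable_integral_BT_sq {T μ : ℝ} (hT : 0 < T) (hμ : 0 < μ) (q : ℝ × ℝ) :
    Integrable fun y : ℝ => (∫ x : ℝ, BT T μ (x, y) q) ^ 2 := by
  set I := ∫ x : ℝ, (1 + x ^ 2) ^ (-(2 / 3) : ℝ)
  have hmeas : StronglyMeasurable fun y : ℝ => ∫ x : ℝ, BT T μ (x, y) q :=
    ((measurable_BT T μ q).stronglyMeasurable).integral_prod_left'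
  refine (integrable_one_add_sq_rpow.const_mul ((((μ + 1) / T + 2) * I) ^ 2)).mono'
    (hmeas.pow 2).aestronglyMeasurable (Filter.Eventually.of_forall fun y => ?_)
  have h0 : 0 ≤ ∫ x : ℝ, BT T μ (x, y) q := integral_nonneg fun x => BT_nonneg hT μ _ q
  have h1 : ∫ x : ℝ, BT T μ (x, y) q ≤
      (((μ + 1) / T + 2) * (1 + y ^ 2) ^ (-(1 / 3) : ℝ)) * I := by
    rw [← integral_const_mul]
    exact integral_mono (integrable_BT_fst hT hμ y q)
      (integrable_one_add_sq_rpow.const_mul _) fun x => BT_le_mul hT hμ x y q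
  rw [Real.norm_of_nonneg (by positivity)]
  refine (pow_le_pow_left₀ h0 h1 2).trans (le_of_eq ?_)
  have e : ((1 + y ^ 2) ^ (-(1 / 3) : ℝ)) ^ 2 = (1 + y ^ 2) ^ (-(2 / 3) : ℝ) := by
    rw [← Real.rpow_natCast, ← Real.rpow_mul (by positivity)]
    norm_num
  rw [← e]
  ring

/-- Just outside the Fermi circle `|p|² = m²`, at distance large compared with `T` and `|q|`,
`B_T` is bounded below by the inverse distance. -/
lemma le_BT_of_outside {T m c δ a x y : ℝ} {q : ℝ × ℝ} (hT : 0 < T) (hm : 0 < m) (hc : 0 < c)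
    (hTδ : T ≤ m ^ 2 * δ ^ 4) (hq : Real.sqrt (q.1 ^ 2 + q.2 ^ 2) ≤ c * m * δ ^ 4)
    (hcδ : c * δ ^ 4 ≤ 1 / 4) (ha : 0 < a) (hay : a ^ 2 + y ^ 2 = m ^ 2)
    (hx1 : a + (8 * c + 4) * m ^ 2 * δ ^ 4 / (2 * a) ≤ x) (hx2 : x ≤ 2 * a) :
    1 / (8 * a * (x - a)) ≤ BT T (m ^ 2) (x, y) q := by
  have hδ : 0 < δ ^ 4 := by
    by_contra hcon
    nlinarith [pow_pos hm 2]
  set r := Real.sqrt (q.1 ^ 2 + q.2 ^ 2) with hr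
  have hr0 : 0 ≤ r := Real.sqrt_nonneg _
  have hr2 : r ^ 2 = q.1 ^ 2 + q.2 ^ 2 := Real.sq_sqrt (by positivity)
  have hxa : 0 < x - a := by
    have : 0 < (8 * c + 4) * m ^ 2 * δ ^ 4 / (2 * a) := by positivity
    linarith
  set s := x ^ 2 + y ^ 2 - m ^ 2 with hs
  have hsx : s = (x - a) * (x + a) := by rw [hs, ← hay]; ring
  have hs1 : (8 * c + 4) * m ^ 2 * δ ^ 4 ≤ s := by
    have h1 : (8 * c + 4) * m ^ 2 * δ ^ 4 / (2 * a) ≤ x - a := by linarith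
    rw [div_le_iff₀ (by positivity)] at h1
    rw [hsx]
    nlinarith
  have hs3 : s ≤ 3 * a * (x - a) := by rw [hsx]; nlinarith
  have hs4 : x ^ 2 + y ^ 2 ≤ (2 * m) ^ 2 := by nlinarith [sq_nonneg y]
  have hspos : 0 < s := lt_of_lt_of_le (by positivity) hs1
  have hcm : 0 ≤ m ^ 2 * δ ^ 4 := by positivity
  have hrs : 8 * m * r ≤ s := by
    have : 8 * m * r ≤ 8 * m * (c * m * δ ^ 4) := by gcongr
    nlinarith
  have hTs : 4 * T ≤ s := by
    nlinarith [mul_nonneg hc.le hcm]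
  have hrm : r ≤ m / 4 := by linarith [mul_le_mul_of_nonneg_left hcδ hm.le]
  have hcs : |x * q.1 + y * q.2| ≤ 2 * m * r := by
    apply abs_le_of_sq_le_sq _ (by positivity)
    have : (x * q.1 + y * q.2) ^ 2 ≤ (x ^ 2 + y ^ 2) * r ^ 2 := by
      rw [hr2]; nlinarith [sq_nonneg (x * q.2 - y * q.1)]
    refine this.trans ?_
    rw [mul_pow (2 * m) r]
    gcongr
  have hcs' := abs_le.1 hcs
  have t1 : 1 / 2 ≤ Real.tanh (((x + q.1) ^ 2 + (y + q.2) ^ 2 - m ^ 2) / (2 * T)) := by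
    apply Real.half_le_tanh
    rw [le_div_iff₀ (by positivity)]
    linarith [sq_nonneg q.1, sq_nonneg q.2]
  have t2 : 1 / 2 ≤ Real.tanh (((x - q.1) ^ 2 + (y - q.2) ^ 2 - m ^ 2) / (2 * T)) := by
    apply Real.half_le_tanh
    rw [le_div_iff₀ (by positivity)]
    linarith [sq_nonneg q.1, sq_nonneg q.2]
  have hD : x ^ 2 + y ^ 2 + q.1 ^ 2 + q.2 ^ 2 - m ^ 2 = s + r ^ 2 := by rw [hr2, hs]; ring
  have hDne : ¬ x ^ 2 + y ^ 2 + q.1 ^ 2 + q.2 ^ 2 = m ^ 2 := by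
    intro h0
    linarith [sq_nonneg r]
  have hr2s : 32 * r ^ 2 ≤ s := by
    linarith [mul_nonneg hr0 (sub_nonneg.2 hrm)]
  simp only [BT, if_neg hDne, hD]
  rw [div_le_div_iff₀ (by positivity) (by positivity)]
  have hsr : 2 * (s + r ^ 2) ≤ 8 * a * (x - a) := by linarith
  have h8 : 0 ≤ 8 * a * (x - a) := by positivity
  exact mul_le_mul (by linarith) hsr (by positivity) (by linarith)

lemma integral_one_div_mul_sub {a b c k : ℝ} (hab : a < b) (hbc : b ≤ c) :
    ∫ x in b..c, 1 / (k * (x - a)) = 1 / k * Real.log ((c - a) / (b - a)) := by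
  have e : (fun x : ℝ => 1 / (k * (x - a))) = fun x => 1 / k * (x - a)⁻¹ := by
    ext x; rw [one_div, mul_inv, one_div]
  rw [e, intervalIntegral.integral_const_mul,
    intervalIntegral.integral_comp_sub_right (fun x => x⁻¹),
    integral_inv_of_pos (by linarith) (by linarith)]

lemma intervalIntegral_le_integral {f g : ℝ → ℝ} {b c : ℝ} (hbc : b ≤ c)
    (hg : ContinuousOn g (Set.Icc b c)) (hf : Integrable f) (hf0 : ∀ x, 0 ≤ f x)
    (hgf : ∀ x ∈ Set.Icc b c, g x ≤ f x) : ∫ x in b..c, g x ≤ ∫ x, f x := by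
  refine (intervalIntegral.integral_mono_on hbc (hg.intervalIntegrable_of_Icc hbc)
    hf.intervalIntegrable hgf).trans ?_
  rw [intervalIntegral.integral_of_le hbc]
  exact setIntegral_le_integral hf (Filter.Eventually.of_forall hf0)

lemma le_integral_BT {T m c δ a y : ℝ} {q : ℝ × ℝ} (hT : 0 < T) (hm : 0 < m) (hc : 0 < c)
    (hδ : 0 < δ) (hTδ : T ≤ m ^ 2 * δ ^ 4)
    (hq : Real.sqrt (q.1 ^ 2 + q.2 ^ 2) ≤ c * m * δ ^ 4)
    (hcδ : (4 * c + 2) * δ ≤ 1) (ha : 0 < a) (hay : a ^ 2 + y ^ 2 = m ^ 2)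
    (haδ : m ^ 2 * δ ^ 2 ≤ a ^ 2) :
    1 / (8 * a) * (-Real.log δ) ≤ ∫ x, BT T (m ^ 2) (x, y) q := by
  set t := (8 * c + 4) * m ^ 2 * δ ^ 4 / (2 * a) with ht
  have ht0 : 0 < t := by positivity
  have hδ1 : δ < 1 := by nlinarith
  have hta : t ≤ a * δ := by
    rw [ht, div_le_iff₀ (by positivity)]
    have h1 : (8 * c + 4) * m ^ 2 * δ ^ 4 = 2 * ((4 * c + 2) * δ) * (m ^ 2 * δ ^ 2) * δ := by ring
    have h2 : 2 * ((4 * c + 2) * δ) * (m ^ 2 * δ ^ 2) * δ ≤ 2 * 1 * a ^ 2 * δ := by gcongr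
    linarith
  have hta' : t ≤ a := by nlinarith
  have hcδ' : c * δ ^ 4 ≤ 1 / 4 := by
    have h4 : δ ^ 4 ≤ δ := by
      have := pow_le_pow_of_le_one hδ.le hδ1.le (show 1 ≤ 4 by norm_num)
      simpa using this
    nlinarith
  have key : ∫ x in (a + t)..(2 * a), 1 / (8 * a * (x - a)) ≤ ∫ x, BT T (m ^ 2) (x, y) q := by
    refine intervalIntegral_le_integral (by linarith) ?_
      (integrable_BT_fst hT (by positivity) y q) (fun x => BT_nonneg hT _ _ q) fun x hx => ?_
    · refine ContinuousOn.div (by fun_prop) (by fun_prop) fun x hx => ?_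
      have : 0 < x - a := by linarith [hx.1]
      positivity
    · exact le_BT_of_outside hT hm hc hTδ hq hcδ' ha hay hx.1 hx.2
  refine le_trans ?_ key
  rw [integral_one_div_mul_sub (by linarith) (by linarith), ← Real.log_inv]
  refine mul_le_mul_of_nonneg_left (Real.log_le_log (by positivity) ?_) (by positivity)
  rw [inv_eq_one_div, div_le_div_iff₀ hδ (by linarith)]
  linarith

lemma le_integral_integral_BT_sq {T m c δ : ℝ} {q : ℝ × ℝ} (hT : 0 < T) (hm : 0 < m)
    (hc : 0 < c) (hδ : 0 < δ) (hTδ : T ≤ m ^ 2 * δ ^ 4)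
    (hq : Real.sqrt (q.1 ^ 2 + q.2 ^ 2) ≤ c * m * δ ^ 4) (hcδ : (4 * c + 2) * δ ≤ 1) :
    1 / (64 * m) * (-Real.log δ) ^ 3 ≤ ∫ y, (∫ x, BT T (m ^ 2) (x, y) q) ^ 2 := by
  have hδ1 : δ < 1 := by nlinarith
  have hδ2 : δ ^ 2 < 1 := by nlinarith
  have hL : 0 < -Real.log δ := by linarith [Real.log_neg hδ hδ1]
  set L := -Real.log δ with hLdef
  have hint : ∫ u in (m * δ ^ 2)..m, L ^ 2 / (128 * m) * u⁻¹ = 1 / (64 * m) * L ^ 3 := by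
    rw [intervalIntegral.integral_const_mul, integral_inv_of_pos (by positivity) hm,
      show m / (m * δ ^ 2) = (δ ^ 2)⁻¹ by field_simp, Real.log_inv, Real.log_pow]
    push_cast
    rw [show -(2 * Real.log δ) = 2 * L by rw [hLdef]; ring]
    field_simp
    norm_num
  have hsub : ∫ y in (0 : ℝ)..(m - m * δ ^ 2), L ^ 2 / (128 * m) * (m - y)⁻¹ =
      1 / (64 * m) * L ^ 3 := by
    rw [intervalIntegral.integral_comp_sub_left (fun u => L ^ 2 / (128 * m) * u⁻¹) m, ← hint]
    simp
  rw [← hsub]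
  refine intervalIntegral_le_integral (by nlinarith) ?_
    (integrable_integral_BT_sq hT (by positivity) q) (fun y => sq_nonneg _) fun y hy => ?_
  · refine continuousOn_const.mul (ContinuousOn.inv₀ (by fun_prop) fun y hy => ?_)
    have : 0 < m * δ ^ 2 := by positivity
    linarith [hy.2]
  · obtain ⟨hy0, hy1⟩ := hy
    have hmy : m * δ ^ 2 ≤ m - y := by linarith
    have hmy0 : 0 < m - y := lt_of_lt_of_le (by positivity) hmy
    have hsq : 0 < m ^ 2 - y ^ 2 := by nlinarith
    have ha2 : Real.sqrt (m ^ 2 - y ^ 2) ^ 2 = m ^ 2 - y ^ 2 := Real.sq_sqrt hsq.le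
    have ha : 0 < Real.sqrt (m ^ 2 - y ^ 2) := Real.sqrt_pos.2 hsq
    set a := Real.sqrt (m ^ 2 - y ^ 2)
    have h := le_integral_BT (a := a) (y := y) hT hm hc hδ hTδ hq hcδ ha (by linarith)
      (by nlinarith)
    refine le_trans ?_ (pow_le_pow_left₀ (by positivity) h 2)
    rw [← hLdef, mul_pow, div_pow, one_pow, mul_pow, ha2, ← div_eq_mul_inv, div_div,
      one_div_mul_eq_div]
    refine div_le_div_of_nonneg_left (by positivity) (by positivity) ?_
    nlinarith

/-- Lower bound `∫ (∫ B_T(p,q) dp₁)² dp₂ ≥ C (log(μ/T))³` for small `T`, uniformly in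
`|q| < c₂ √μ (T/μ)^β`. -/
theorem BT_integral_lower_bound (μ c₂ β : ℝ) (hμ : 0 < μ) (hc₂ : 0 < c₂)
    (hβ0 : 0 < β) (hβ1 : β < 1) :
    ∃ T₀ > (0 : ℝ), ∃ C > (0 : ℝ), ∀ T, 0 < T → T < T₀ →
      ∀ q : ℝ × ℝ, Real.sqrt (q.1 ^ 2 + q.2 ^ 2) < c₂ * Real.sqrt μ * (T / μ) ^ β →
        C * (Real.log (μ / T)) ^ 3 ≤
          ∫ p₂ : ℝ, (∫ p₁ : ℝ, BT T μ (p₁, p₂) q) ^ 2 := by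
  have hsm : 0 < Real.sqrt μ := Real.sqrt_pos.2 hμ
  have hsq : Real.sqrt μ ^ 2 = μ := Real.sq_sqrt hμ.le
  refine ⟨μ * (1 / (4 * c₂ + 2)) ^ (4 / β), by positivity,
    (β / 4) ^ 3 / (64 * Real.sqrt μ), by positivity, fun T hT hTT q hq => ?_⟩
  have hτ : 0 < T / μ := by positivity
  have hτ' : T / μ < (1 / (4 * c₂ + 2)) ^ (4 / β) := by
    rw [div_lt_iff₀ hμ]; linarith
  have hτ1 : T / μ ≤ 1 := hτ'.le.trans <| Real.rpow_le_one (by positivity)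
    (by rw [div_le_one (by positivity)]; linarith) (by positivity)
  set δ := (T / μ) ^ (β / 4) with hδ
  have hδ4 : δ ^ 4 = (T / μ) ^ β := by
    rw [hδ, ← Real.rpow_natCast, ← Real.rpow_mul hτ.le]
    norm_num
  have hδc : δ ≤ 1 / (4 * c₂ + 2) := by
    have := Real.rpow_le_rpow hτ.le hτ'.le (show 0 ≤ β / 4 by positivity)
    rwa [← Real.rpow_mul (by positivity), show 4 / β * (β / 4) = 1 by field_simp,
      Real.rpow_one] at this
  have hTδ : T ≤ Real.sqrt μ ^ 2 * δ ^ 4 := by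
    have := Real.rpow_le_rpow_of_exponent_ge hτ hτ1 hβ1.le
    rw [Real.rpow_one, div_le_iff₀ hμ] at this
    rw [hsq, hδ4]
    linarith
  have h := le_integral_integral_BT_sq (δ := δ) (q := q) hT hsm hc₂ (by positivity) hTδ
    (by rw [hδ4]; exact hq.le)
    (by rw [le_div_iff₀ (by positivity)] at hδc; linarith)
  have hlog : -Real.log δ = β / 4 * Real.log (μ / T) := by
    rw [hδ, Real.log_rpow hτ, ← inv_div μ T, Real.log_inv]
    ring
  rw [hsq, hlog] at h
  refine le_trans (le_of_eq ?_) h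
  ring
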